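/- arXiv:1809.06826 — 2 statements merged into one kernel-verified Lean document; each statement's English description precedes it below -/
import Mathlib

section
/- The pair (U,P) is H-trichotomic if and only if there exists a nondecreasing function N : ℝ₊ → [1,∞) such that for all (t,s) ∈ Δ and x ∈ X: h₁(t)‖U(t,s)P₁(s)x‖ ≤ N(s)h₁(s)‖P₁(s)x‖, h₂(t)‖P₂(s)x‖ ≤ N(t)h₂(s)‖U(t,s)P₂(s)x‖, h₃(s)‖U(t,s)P₃(s)x‖ ≤ N(s)h₃(t)‖P₃(s)x‖, and h₄(s)‖P₃(s)x‖ ≤ N(t)h₄(t)‖U(t,s)P₃(s)x‖. -/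
open Filter

/-- `M : ℝ₊ → [1,∞)` nondecreasing, encoded on `ℝ` with conditions on `ℝ₊`. -/
def NondecOne (M : ℝ → ℝ) : Prop :=
  (∀ s t : ℝ, 0 ≤ s → s ≤ t → M s ≤ M t) ∧ ∀ t : ℝ, 0 ≤ t → 1 ≤ M t

/-- A growth rate: nondecreasing `h : ℝ₊ → [1,∞)` with `h(t) → ∞`. -/
def GrowthRate (h : ℝ → ℝ) : Prop :=
  NondecOne h ∧ Tendsto h atTop atTop

theorem exists_nondecOne_ge (f : ℝ → ℝ)
    (hf : ∀ t : ℝ, 0 ≤ t → ∃ C : ℝ, ∀ s : ℝ, 0 ≤ s → s ≤ t → f s ≤ C) :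
    ∃ M : ℝ → ℝ, NondecOne M ∧ ∀ t : ℝ, 0 ≤ t → f t ≤ M t := by
  have bdd : ∀ t : ℝ, 0 ≤ t → BddAbove (f '' Set.Icc 0 t) := by
    intro t ht
    obtain ⟨C, hC⟩ := hf t ht
    refine ⟨C, ?_⟩
    rintro _ ⟨s, hs, rfl⟩
    exact hC s hs.1 hs.2
  refine ⟨fun t => max 1 (sSup (f '' Set.Icc 0 t)), ⟨?_, ?_⟩, ?_⟩
  · intro s t hs hst
    refine max_le_max le_rfl (csSup_le_csSup (bdd t (hs.trans hst)) ?_ ?_)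
    · exact ⟨f s, s, ⟨hs, le_rfl⟩, rfl⟩
    · exact Set.image_mono (Set.Icc_subset_Icc_right hst)
  · intro t _
    exact le_max_left _ _
  · intro t ht
    exact (le_csSup (bdd t ht) ⟨t, ⟨ht, le_rfl⟩, rfl⟩).trans (le_max_right _ _)

theorem NondecOne.mul {M N : ℝ → ℝ} (hM : NondecOne M) (hN : NondecOne N) :
    NondecOne (fun t => M t * N t) := by
  refine ⟨fun s t hs hst => ?_, fun t ht => one_le_mul_of_one_le_of_one_le (hM.2 t ht) (hN.2 t ht)⟩
  exact mul_le_mul (hM.1 s t hs hst) (hN.1 s t hs hst)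
    (zero_le_one.trans (hN.2 s hs)) (zero_le_one.trans (hM.2 t (hs.trans hst)))

theorem le_mul_norm_of_le_mul_norm_apply {X : Type*} [NormedAddCommGroup X] [NormedSpace ℝ X]
    {P : X →L[ℝ] X} {a n m h : ℝ} {x : X} (hn : 0 ≤ n) (hh : 0 ≤ h) (hP : ‖P‖ ≤ m)
    (ha : a ≤ n * (h * ‖P x‖)) : a ≤ n * m * (h * ‖x‖) := by
  calc a ≤ n * (h * ‖P x‖) := ha
    _ ≤ n * (h * (m * ‖x‖)) := by
      gcongr
      exact P.le_of_opNorm_le hP x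
    _ = n * m * (h * ‖x‖) := by ring

/-- Proposition 3 (characterization of H-trichotomy). -/
theorem prop_trichotomy_characterization
    {X : Type*} [NormedAddCommGroup X] [NormedSpace ℝ X] [CompleteSpace X]
    (U V₂ V₃ : ℝ → ℝ → X →L[ℝ] X)
    (P₁ P₂ P₃ : ℝ → X →L[ℝ] X)
    (h₁ h₂ h₃ h₄ : ℝ → ℝ)
    -- U is an evolution operator
    (hU_id : ∀ t : ℝ, 0 ≤ t → U t t = 1)
    (hU_cocycle : ∀ t s t₀ : ℝ, 0 ≤ t₀ → t₀ ≤ s → s ≤ t →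
      U t t₀ = (U t s).comp (U s t₀))
    -- families of projectors
    (hP₁proj : ∀ t : ℝ, 0 ≤ t → (P₁ t).comp (P₁ t) = P₁ t)
    (hP₂proj : ∀ t : ℝ, 0 ≤ t → (P₂ t).comp (P₂ t) = P₂ t)
    (hP₃proj : ∀ t : ℝ, 0 ≤ t → (P₃ t).comp (P₃ t) = P₃ t)
    -- orthogonal family
    (hsum : ∀ t : ℝ, 0 ≤ t → P₁ t + P₂ t + P₃ t = 1)
    (horth : ∀ t : ℝ, 0 ≤ t →
      (P₁ t).comp (P₂ t) = 0 ∧ (P₂ t).comp (P₁ t) = 0 ∧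
      (P₁ t).comp (P₃ t) = 0 ∧ (P₃ t).comp (P₁ t) = 0 ∧
      (P₂ t).comp (P₃ t) = 0 ∧ (P₃ t).comp (P₂ t) = 0)
    -- invariance (compatibility)
    (hinv₁ : ∀ t s : ℝ, 0 ≤ s → s ≤ t → (U t s).comp (P₁ s) = (P₁ t).comp (U t s))
    (hinv₂ : ∀ t s : ℝ, 0 ≤ s → s ≤ t → (U t s).comp (P₂ s) = (P₂ t).comp (U t s))
    (hinv₃ : ∀ t s : ℝ, 0 ≤ s → s ≤ t → (U t s).comp (P₃ s) = (P₃ t).comp (U t s))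
    -- strong invariance of P₂, P₃, via the associated maps V₂, V₃
    (hV₂UV : ∀ (t s : ℝ) (x : X), 0 ≤ s → s ≤ t → U t s (V₂ t s (P₂ t x)) = P₂ t x)
    (hV₂VU : ∀ (t s : ℝ) (x : X), 0 ≤ s → s ≤ t → V₂ t s (U t s (P₂ s x)) = P₂ s x)
    (hV₂rng : ∀ (t s : ℝ) (x : X), 0 ≤ s → s ≤ t →
      V₂ t s (P₂ t x) = P₂ s (V₂ t s (P₂ t x)))
    (hV₃UV : ∀ (t s : ℝ) (x : X), 0 ≤ s → s ≤ t → U t s (V₃ t s (P₃ t x)) = P₃ t x)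
    (hV₃VU : ∀ (t s : ℝ) (x : X), 0 ≤ s → s ≤ t → V₃ t s (U t s (P₃ s x)) = P₃ s x)
    (hV₃rng : ∀ (t s : ℝ) (x : X), 0 ≤ s → s ≤ t →
      V₃ t s (P₃ t x) = P₃ s (V₃ t s (P₃ t x)))
    -- growth rates
    (hg₁ : GrowthRate h₁) (hg₂ : GrowthRate h₂)
    (hg₃ : GrowthRate h₃) (hg₄ : GrowthRate h₄)
    -- boundedness of the projectors on compact time intervals
    (hbdd : ∀ t : ℝ, 0 ≤ t → ∃ C : ℝ, ∀ s : ℝ, 0 ≤ s → s ≤ t →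
      ‖P₁ s‖ + ‖P₂ s‖ + ‖P₃ s‖ ≤ C)
    :
    (∃ N : ℝ → ℝ, NondecOne N ∧
      ∀ (t s : ℝ) (x : X), 0 ≤ s → s ≤ t →
        h₁ t * ‖U t s (P₁ s x)‖ ≤ N s * (h₁ s * ‖x‖) ∧
        h₂ t * ‖V₂ t s (P₂ t x)‖ ≤ N t * (h₂ s * ‖x‖) ∧
        h₃ s * ‖U t s (P₃ s x)‖ ≤ N s * (h₃ t * ‖x‖) ∧
        h₄ s * ‖V₃ t s (P₃ t x)‖ ≤ N t * (h₄ t * ‖x‖)) ↔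
    (∃ N : ℝ → ℝ, NondecOne N ∧
      ∀ (t s : ℝ) (x : X), 0 ≤ s → s ≤ t →
        h₁ t * ‖U t s (P₁ s x)‖ ≤ N s * (h₁ s * ‖P₁ s x‖) ∧
        h₂ t * ‖P₂ s x‖ ≤ N t * (h₂ s * ‖U t s (P₂ s x)‖) ∧
        h₃ s * ‖U t s (P₃ s x)‖ ≤ N s * (h₃ t * ‖P₃ s x‖) ∧
        h₄ s * ‖P₃ s x‖ ≤ N t * (h₄ t * ‖U t s (P₃ s x)‖)) := by
  constructor
  · rintro ⟨N, hN, H⟩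
    refine ⟨N, hN, fun t s x hs hst => ?_⟩
    have e₁ : P₁ s (P₁ s x) = P₁ s x := DFunLike.congr_fun (hP₁proj s hs) x
    have e₂ : P₂ s (P₂ s x) = P₂ s x := DFunLike.congr_fun (hP₂proj s hs) x
    have e₃ : P₃ s (P₃ s x) = P₃ s x := DFunLike.congr_fun (hP₃proj s hs) x
    have i₂ : U t s (P₂ s (P₂ s x)) = P₂ t (U t s (P₂ s x)) :=
      DFunLike.congr_fun (hinv₂ t s hs hst) (P₂ s x)
    have i₃ : U t s (P₃ s (P₃ s x)) = P₃ t (U t s (P₃ s x)) :=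
      DFunLike.congr_fun (hinv₃ t s hs hst) (P₃ s x)
    rw [e₂] at i₂
    rw [e₃] at i₃
    have b₁ := (H t s (P₁ s x) hs hst).1
    have b₂ := (H t s (U t s (P₂ s x)) hs hst).2.1
    have b₃ := (H t s (P₃ s x) hs hst).2.2.1
    have b₄ := (H t s (U t s (P₃ s x)) hs hst).2.2.2
    rw [e₁] at b₁
    rw [← i₂, hV₂VU t s x hs hst] at b₂
    rw [e₃] at b₃
    rw [← i₃, hV₃VU t s x hs hst] at b₄
    exact ⟨b₁, b₂, b₃, b₄⟩
  · rintro ⟨N, hN, H⟩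
    obtain ⟨M, hM, hPM⟩ := exists_nondecOne_ge _ hbdd
    refine ⟨fun t => N t * M t, hN.mul hM, fun t s x hs hst => ?_⟩
    have ht : 0 ≤ t := hs.trans hst
    have bound : ∀ r : ℝ, 0 ≤ r → ‖P₁ r‖ ≤ M r ∧ ‖P₂ r‖ ≤ M r ∧ ‖P₃ r‖ ≤ M r := by
      intro r hr
      have := hPM r hr
      have := norm_nonneg (P₁ r)
      have := norm_nonneg (P₂ r)
      have := norm_nonneg (P₃ r)
      refine ⟨?_, ?_, ?_⟩ <;> linarith
    have nonneg : ∀ {f : ℝ → ℝ}, NondecOne f → ∀ r : ℝ, 0 ≤ r → 0 ≤ f r :=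
      fun hf r hr => zero_le_one.trans (hf.2 r hr)
    have b₂ := (H t s (V₂ t s (P₂ t x)) hs hst).2.1
    have b₄ := (H t s (V₃ t s (P₃ t x)) hs hst).2.2.2
    rw [← hV₂rng t s x hs hst, hV₂UV t s x hs hst] at b₂
    rw [← hV₃rng t s x hs hst, hV₃UV t s x hs hst] at b₄
    exact ⟨le_mul_norm_of_le_mul_norm_apply (nonneg hN s hs) (nonneg hg₁.1 s hs)
        (bound s hs).1 (H t s x hs hst).1,
      le_mul_norm_of_le_mul_norm_apply (nonneg hN t ht) (nonneg hg₂.1 s hs)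
        (bound t ht).2.1 b₂,
      le_mul_norm_of_le_mul_norm_apply (nonneg hN s hs) (nonneg hg₃.1 t ht)
        (bound s hs).2.2 (H t s x hs hst).2.2.1,
      le_mul_norm_of_le_mul_norm_apply (nonneg hN t ht) (nonneg hg₄.1 t ht)
        (bound t ht).2.2 b₄⟩
end

section
/- If the pair (U,P) is H-trichotomic with nondecreasing function N : ℝ₊ → [1,∞), then the function L : ℝ₊ × X → ℝ₊ defined by L(t,x) = sup_{τ ≥ t} (h₁(t)/h₁(τ))‖U(τ,t)P₁(t)x‖ + sup_{r ≤ t} (h₂(r)/h₂(t))‖V₂(t,r)P₂(t)x‖ + sup_{τ ≥ t} (h₃(t)/h₃(τ))‖U(τ,t)P₃(t)x‖ + sup_{r ≤ t} (h₄(r)/h₄(t))‖V₃(t,r)P₃(t)x‖ is an H-Lyapunov function for (U,P); in fact it satisfies all the H-Lyapunov conditions with T(t) = 4N(t). -/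
open Filter

/-- Backward maps of a strongly invariant family of projectors satisfy the backward cocycle
identity. -/
theorem backward_cocycle {X : Type*} [NormedAddCommGroup X] [NormedSpace ℝ X]
    {U V : ℝ → ℝ → X →L[ℝ] X} {P : ℝ → X →L[ℝ] X}
    (hU : ∀ t s t₀ : ℝ, 0 ≤ t₀ → t₀ ≤ s → s ≤ t → U t t₀ = (U t s).comp (U s t₀))
    (hUV : ∀ (t s : ℝ) (x : X), 0 ≤ s → s ≤ t → U t s (V t s (P t x)) = P t x)
    (hVU : ∀ (t s : ℝ) (x : X), 0 ≤ s → s ≤ t → V t s (U t s (P s x)) = P s x)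
    (hrng : ∀ (t s : ℝ) (x : X), 0 ≤ s → s ≤ t → V t s (P t x) = P s (V t s (P t x)))
    {r s t : ℝ} (hr : 0 ≤ r) (hrs : r ≤ s) (hst : s ≤ t) (x : X) :
    V s r (P s (V t s (P t x))) = V t r (P t x) := by
  have hUr : U t r (V s r (P s (V t s (P t x)))) = P t x := by
    rw [hU t s r hr hrs hst, ContinuousLinearMap.comp_apply, hUV s r _ hr hrs,
      ← hrng t s x (hr.trans hrs) hst, hUV t s x (hr.trans hrs) hst]
  have h := hVU t r (V s r (P s (V t s (P t x)))) hr (hrs.trans hst)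
  rw [← hrng s r _ hr hrs, hUr] at h
  exact h.symm

/-- A backward map at coinciding times is the identity on the range of the projector. -/
theorem backward_self {X : Type*} [NormedAddCommGroup X] [NormedSpace ℝ X]
    {U V : ℝ → ℝ → X →L[ℝ] X} {P : ℝ → X →L[ℝ] X} (hU : ∀ t : ℝ, 0 ≤ t → U t t = 1)
    (hUV : ∀ (t s : ℝ) (x : X), 0 ≤ s → s ≤ t → U t s (V t s (P t x)) = P t x)
    {t : ℝ} (ht : 0 ≤ t) (x : X) : V t t (P t x) = P t x := by
  simpa [hU t ht] using hUV t t x ht le_rfl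

/-- Forward evolution undoes the corresponding part of a backward map. -/
theorem forward_backward {X : Type*} [NormedAddCommGroup X] [NormedSpace ℝ X]
    {U V : ℝ → ℝ → X →L[ℝ] X} {P : ℝ → X →L[ℝ] X}
    (hU : ∀ t s t₀ : ℝ, 0 ≤ t₀ → t₀ ≤ s → s ≤ t → U t t₀ = (U t s).comp (U s t₀))
    (hUV : ∀ (t s : ℝ) (x : X), 0 ≤ s → s ≤ t → U t s (V t s (P t x)) = P t x)
    (hVU : ∀ (t s : ℝ) (x : X), 0 ≤ s → s ≤ t → V t s (U t s (P s x)) = P s x)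
    (hrng : ∀ (t s : ℝ) (x : X), 0 ≤ s → s ≤ t → V t s (P t x) = P s (V t s (P t x)))
    {r s t : ℝ} (hr : 0 ≤ r) (hrs : r ≤ s) (hst : s ≤ t) (x : X) :
    U s r (V t r (P t x)) = V t s (P t x) := by
  rw [← backward_cocycle hU hUV hVU hrng hr hrs hst, hUV s r _ hr hrs,
    ← hrng t s x (hr.trans hrs) hst]

theorem range_invariant {X : Type*} [NormedAddCommGroup X] [NormedSpace ℝ X]
    {U P Q : X →L[ℝ] X} (hP : P.comp P = P) (hinv : U.comp P = Q.comp U) (x : X) :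
    Q (U (P x)) = U (P x) := by
  have h := DFunLike.congr_fun hinv (P x)
  have h' := DFunLike.congr_fun hP x
  simp only [ContinuousLinearMap.comp_apply] at h h'
  rw [← h, h']

theorem GrowthRate.pos {h : ℝ → ℝ} (hg : GrowthRate h) {t : ℝ} (ht : 0 ≤ t) : 0 < h t :=
  zero_lt_one.trans_le (hg.1.2 t ht)

theorem GrowthRate.mono {h : ℝ → ℝ} (hg : GrowthRate h) {s t : ℝ} (hs : 0 ≤ s) (hst : s ≤ t) :
    h s ≤ h t :=
  hg.1.1 s t hs hst

theorem GrowthRate.div_le_one {h : ℝ → ℝ} (hg : GrowthRate h) {s t : ℝ} (hs : 0 ≤ s)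
    (hst : s ≤ t) : h s / h t ≤ 1 :=
  (div_le_one₀ (hg.pos (hs.trans hst))).2 (hg.mono hs hst)

/-- If (U,P) is H-trichotomic with nondecreasing N, then the canonical
function L is an H-Lyapunov function for (U,P), with T(t) = 4 N(t). -/
theorem thm_L_is_lyapunov
    {X : Type*} [NormedAddCommGroup X] [NormedSpace ℝ X] [CompleteSpace X]
    (U V₂ V₃ : ℝ → ℝ → X →L[ℝ] X)
    (P₁ P₂ P₃ : ℝ → X →L[ℝ] X)
    (h₁ h₂ h₃ h₄ : ℝ → ℝ)
    -- U is an evolution operator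
    (hU_id : ∀ t : ℝ, 0 ≤ t → U t t = 1)
    (hU_cocycle : ∀ t s t₀ : ℝ, 0 ≤ t₀ → t₀ ≤ s → s ≤ t →
      U t t₀ = (U t s).comp (U s t₀))
    -- families of projectors
    (hP₁proj : ∀ t : ℝ, 0 ≤ t → (P₁ t).comp (P₁ t) = P₁ t)
    (hP₂proj : ∀ t : ℝ, 0 ≤ t → (P₂ t).comp (P₂ t) = P₂ t)
    (hP₃proj : ∀ t : ℝ, 0 ≤ t → (P₃ t).comp (P₃ t) = P₃ t)
    -- orthogonal family
    (hsum : ∀ t : ℝ, 0 ≤ t → P₁ t + P₂ t + P₃ t = 1)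
    (horth : ∀ t : ℝ, 0 ≤ t →
      (P₁ t).comp (P₂ t) = 0 ∧ (P₂ t).comp (P₁ t) = 0 ∧
      (P₁ t).comp (P₃ t) = 0 ∧ (P₃ t).comp (P₁ t) = 0 ∧
      (P₂ t).comp (P₃ t) = 0 ∧ (P₃ t).comp (P₂ t) = 0)
    -- invariance (compatibility)
    (hinv₁ : ∀ t s : ℝ, 0 ≤ s → s ≤ t → (U t s).comp (P₁ s) = (P₁ t).comp (U t s))
    (hinv₂ : ∀ t s : ℝ, 0 ≤ s → s ≤ t → (U t s).comp (P₂ s) = (P₂ t).comp (U t s))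
    (hinv₃ : ∀ t s : ℝ, 0 ≤ s → s ≤ t → (U t s).comp (P₃ s) = (P₃ t).comp (U t s))
    -- strong invariance of P₂, P₃, via the associated maps V₂, V₃
    (hV₂UV : ∀ (t s : ℝ) (x : X), 0 ≤ s → s ≤ t → U t s (V₂ t s (P₂ t x)) = P₂ t x)
    (hV₂VU : ∀ (t s : ℝ) (x : X), 0 ≤ s → s ≤ t → V₂ t s (U t s (P₂ s x)) = P₂ s x)
    (hV₂rng : ∀ (t s : ℝ) (x : X), 0 ≤ s → s ≤ t →
      V₂ t s (P₂ t x) = P₂ s (V₂ t s (P₂ t x)))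
    (hV₃UV : ∀ (t s : ℝ) (x : X), 0 ≤ s → s ≤ t → U t s (V₃ t s (P₃ t x)) = P₃ t x)
    (hV₃VU : ∀ (t s : ℝ) (x : X), 0 ≤ s → s ≤ t → V₃ t s (U t s (P₃ s x)) = P₃ s x)
    (hV₃rng : ∀ (t s : ℝ) (x : X), 0 ≤ s → s ≤ t →
      V₃ t s (P₃ t x) = P₃ s (V₃ t s (P₃ t x)))
    -- growth rates
    (hg₁ : GrowthRate h₁) (hg₂ : GrowthRate h₂)
    (hg₃ : GrowthRate h₃) (hg₄ : GrowthRate h₄)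
    -- (U, P) is H-trichotomic with nondecreasing N
    (N : ℝ → ℝ) (hN : NondecOne N)
    (htri : ∀ (t s : ℝ) (x : X), 0 ≤ s → s ≤ t →
            h₁ t * ‖U t s (P₁ s x)‖ ≤ N s * (h₁ s * ‖x‖) ∧
            h₂ t * ‖V₂ t s (P₂ t x)‖ ≤ N t * (h₂ s * ‖x‖) ∧
            h₃ s * ‖U t s (P₃ s x)‖ ≤ N s * (h₃ t * ‖x‖) ∧
            h₄ s * ‖V₃ t s (P₃ t x)‖ ≤ N t * (h₄ t * ‖x‖))
    -- the function L
    (L : ℝ → X → ℝ)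
    (hL : ∀ (t : ℝ) (x : X), 0 ≤ t → L t x =
        (⨆ τ : {τ : ℝ // t ≤ τ}, h₁ t / h₁ τ.1 * ‖U τ.1 t (P₁ t x)‖) +
        (⨆ r : {r : ℝ // 0 ≤ r ∧ r ≤ t}, h₂ r.1 / h₂ t * ‖V₂ t r.1 (P₂ t x)‖) +
        (⨆ τ : {τ : ℝ // t ≤ τ}, h₃ t / h₃ τ.1 * ‖U τ.1 t (P₃ t x)‖) +
        (⨆ r : {r : ℝ // 0 ≤ r ∧ r ≤ t}, h₄ r.1 / h₄ t * ‖V₃ t r.1 (P₃ t x)‖)) :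
    (∀ (t : ℝ) (x : X), 0 ≤ t → ‖x‖ ≤ L t x ∧ L t x ≤ (4 * N t) * ‖x‖) ∧
    ∀ (t s : ℝ) (x : X), 0 ≤ s → s ≤ t →
      h₁ t * L t (U t s (P₁ s x)) ≤ (4 * N s) * (h₁ s * L s x) ∧
      h₂ t * L s (V₂ t s (P₂ t x)) ≤ (4 * N t) * (h₂ s * L t x) ∧
      h₃ s * L t (U t s (P₃ s x)) ≤ (4 * N s) * (h₃ t * L s x) ∧
      h₄ s * L s (V₃ t s (P₃ t x)) ≤ (4 * N t) * (h₄ t * L t x) := by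
  have key₁ : ∀ (τ t s : ℝ) (x : X), 0 ≤ s → s ≤ t → t ≤ τ →
      h₁ t / h₁ τ * ‖U τ s (P₁ s x)‖ ≤ N s * (h₁ s * ‖x‖) / h₁ t := by
    intro τ t s x hs hst htτ
    have ht := hs.trans hst
    have hpt := hg₁.pos ht
    rw [le_div_iff₀ hpt]
    calc h₁ t / h₁ τ * ‖U τ s (P₁ s x)‖ * h₁ t
        ≤ 1 * ‖U τ s (P₁ s x)‖ * h₁ τ := by
          gcongr
          · exact hg₁.div_le_one ht htτ
          · exact hg₁.mono ht htτ
      _ ≤ N s * (h₁ s * ‖x‖) := by linarith [(htri τ s x hs (hst.trans htτ)).1]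
  have key₂ : ∀ (r s t : ℝ) (x : X), 0 ≤ r → r ≤ s → s ≤ t →
      h₂ r / h₂ s * ‖V₂ t r (P₂ t x)‖ ≤ N t * (h₂ s * ‖x‖) / h₂ t := by
    intro r s t x hr hrs hst
    have hs := hr.trans hrs
    have ht := hs.trans hst
    have hNt : 0 ≤ N t := zero_le_one.trans (hN.2 t ht)
    rw [le_div_iff₀ (hg₂.pos ht)]
    calc h₂ r / h₂ s * ‖V₂ t r (P₂ t x)‖ * h₂ t
        ≤ 1 * ‖V₂ t r (P₂ t x)‖ * h₂ t := by
          have := hg₂.pos ht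
          gcongr
          exact hg₂.div_le_one hr hrs
      _ ≤ N t * (h₂ r * ‖x‖) := by linarith [(htri t r x hr (hrs.trans hst)).2.1]
      _ ≤ N t * (h₂ s * ‖x‖) := by
          gcongr
          exact hg₂.mono hr hrs
  have key₃ : ∀ (τ t s : ℝ) (x : X), 0 ≤ s → s ≤ t → t ≤ τ →
      h₃ t / h₃ τ * ‖U τ s (P₃ s x)‖ ≤ N s * (h₃ t * ‖x‖) / h₃ s := by
    intro τ t s x hs hst htτ
    have ht := hs.trans hst
    have hpt := hg₃.pos ht
    have hpτ := hg₃.pos (ht.trans htτ)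
    rw [le_div_iff₀ (hg₃.pos hs)]
    calc h₃ t / h₃ τ * ‖U τ s (P₃ s x)‖ * h₃ s
        = h₃ t / h₃ τ * (h₃ s * ‖U τ s (P₃ s x)‖) := by ring
      _ ≤ h₃ t / h₃ τ * (N s * (h₃ τ * ‖x‖)) := by
          gcongr ?_ * ?_
          exact (htri τ s x hs (hst.trans htτ)).2.2.1
      _ = N s * (h₃ t * ‖x‖) := by field_simp
  have key₄ : ∀ (r s t : ℝ) (x : X), 0 ≤ r → r ≤ s → s ≤ t →
      h₄ r / h₄ s * ‖V₃ t r (P₃ t x)‖ ≤ N t * (h₄ t * ‖x‖) / h₄ s := by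
    intro r s t x hr hrs hst
    rw [div_mul_eq_mul_div]
    have := hg₄.pos (hr.trans hrs)
    gcongr ?_ / _
    exact (htri t r x hr (hrs.trans hst)).2.2.2
  have bound : ∀ (t : ℝ) (x : X), 0 ≤ t → ‖x‖ ≤ L t x ∧ L t x ≤ (4 * N t) * ‖x‖ := by
    intro t x ht
    have : Nonempty {τ : ℝ // t ≤ τ} := ⟨⟨t, le_rfl⟩⟩
    have : Nonempty {r : ℝ // 0 ≤ r ∧ r ≤ t} := ⟨⟨t, ht, le_rfl⟩⟩
    have cancel : ∀ {h : ℝ → ℝ}, GrowthRate h → N t * (h t * ‖x‖) / h t = N t * ‖x‖ := by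
      intro h hg
      have := hg.pos ht
      field_simp
    have b₁ : ∀ τ : {τ : ℝ // t ≤ τ}, h₁ t / h₁ τ.1 * ‖U τ.1 t (P₁ t x)‖ ≤ N t * ‖x‖ :=
      fun τ => (key₁ τ.1 t t x ht le_rfl τ.2).trans_eq (cancel hg₁)
    have b₂ : ∀ r : {r : ℝ // 0 ≤ r ∧ r ≤ t},
        h₂ r.1 / h₂ t * ‖V₂ t r.1 (P₂ t x)‖ ≤ N t * ‖x‖ :=
      fun r => (key₂ r.1 t t x r.2.1 r.2.2 le_rfl).trans_eq (cancel hg₂)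
    have b₃ : ∀ τ : {τ : ℝ // t ≤ τ}, h₃ t / h₃ τ.1 * ‖U τ.1 t (P₃ t x)‖ ≤ N t * ‖x‖ :=
      fun τ => (key₃ τ.1 t t x ht le_rfl τ.2).trans_eq (cancel hg₃)
    have b₄ : ∀ r : {r : ℝ // 0 ≤ r ∧ r ≤ t},
        h₄ r.1 / h₄ t * ‖V₃ t r.1 (P₃ t x)‖ ≤ N t * ‖x‖ :=
      fun r => (key₄ r.1 t t x r.2.1 r.2.2 le_rfl).trans_eq (cancel hg₄)
    rw [hL t x ht]
    refine ⟨?_, by linarith [ciSup_le b₁, ciSup_le b₂, ciSup_le b₃, ciSup_le b₄]⟩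
    have l₁ := le_ciSup (Set.forall_mem_range.2 b₁ |> fun h => ⟨_, h⟩) ⟨t, le_rfl⟩
    have l₂ := le_ciSup (Set.forall_mem_range.2 b₂ |> fun h => ⟨_, h⟩) ⟨t, ht, le_rfl⟩
    have l₃ := le_ciSup (Set.forall_mem_range.2 b₃ |> fun h => ⟨_, h⟩) ⟨t, le_rfl⟩
    have l₄ := le_ciSup (Set.forall_mem_range.2 b₄ |> fun h => ⟨_, h⟩) ⟨t, ht, le_rfl⟩
    simp only [div_self (hg₁.pos ht).ne', div_self (hg₂.pos ht).ne', div_self (hg₃.pos ht).ne',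
      div_self (hg₄.pos ht).ne', one_mul, hU_id t ht, ContinuousLinearMap.one_def, ContinuousLinearMap.id_apply,
      backward_self hU_id hV₂UV ht, backward_self hU_id hV₃UV ht] at l₁ l₂ l₃ l₄
    have hx : x = P₁ t x + P₂ t x + P₃ t x := by
      simpa using (DFunLike.congr_fun (hsum t ht) x).symm
    have hn : ‖x‖ ≤ ‖P₁ t x‖ + ‖P₂ t x‖ + ‖P₃ t x‖ := by
      conv_lhs => rw [hx]
      exact norm_add₃_le
    linarith [norm_nonneg (P₃ t x)]
  refine ⟨bound, fun t s x hs hst => ?_⟩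
  have ht := hs.trans hst
  have : Nonempty {τ : ℝ // t ≤ τ} := ⟨⟨t, le_rfl⟩⟩
  have : Nonempty {r : ℝ // 0 ≤ r ∧ r ≤ s} := ⟨⟨s, hs, le_rfl⟩⟩
  have : Nonempty {r : ℝ // 0 ≤ r ∧ r ≤ t} := ⟨⟨t, ht, le_rfl⟩⟩
  have : Nonempty {τ : ℝ // s ≤ τ} := ⟨⟨s, le_rfl⟩⟩
  have forward : ∀ {P Q : ℝ → X →L[ℝ] X},
      (U t s).comp (P s) = (P t).comp (U t s) → (P s).comp (Q s) = 0 →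
      P t (U t s (Q s x)) = 0 := by
    intro P Q hP hPQ
    have h := DFunLike.congr_fun hP (Q s x)
    have h' := DFunLike.congr_fun hPQ x
    simp only [ContinuousLinearMap.comp_apply, zero_apply] at h h'
    rw [← h, h', map_zero]
  have backward : ∀ {P Q : X →L[ℝ] X} {y : X}, y = Q y → P.comp Q = 0 → P y = 0 := by
    intro P Q y hy hPQ
    rw [hy]
    exact DFunLike.congr_fun hPQ y
  have evolve : ∀ {Q : ℝ → X →L[ℝ] X}, (U t s).comp (Q s) = (Q t).comp (U t s) →
      (Q s).comp (Q s) = Q s → ∀ τ, t ≤ τ → U τ t (Q t (U t s (Q s x))) = U τ s (Q s x) := by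
    intro Q hQ hQQ τ hτ
    rw [range_invariant hQQ hQ, hU_cocycle τ t s hs hst hτ, ContinuousLinearMap.comp_apply]
  have gain₂ : ∀ {u v a b : ℝ}, 0 ≤ u → 0 ≤ v → a ≤ b → 0 ≤ a →
      u * (v * a) + u * (v * a) ≤ 4 * u * (v * b) := by
    intro u v a b hu hv hab ha
    have h : u * (v * a) ≤ u * (v * b) := by gcongr
    linarith [mul_nonneg hu (mul_nonneg hv (ha.trans hab))]
  have gain : ∀ {u v a b : ℝ}, 0 ≤ u → 0 ≤ v → a ≤ b → 0 ≤ a →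
      u * (v * a) ≤ 4 * u * (v * b) := fun hu hv hab ha =>
    (le_add_of_nonneg_right (mul_nonneg hu (mul_nonneg hv ha))).trans (gain₂ hu hv hab ha)
  have hNs : 0 ≤ N s := zero_le_one.trans (hN.2 s hs)
  have hNt : 0 ≤ N t := zero_le_one.trans (hN.2 t ht)
  obtain ⟨o₁₂, o₂₁, o₁₃, o₃₁, o₂₃, o₃₂⟩ := horth s hs
  refine ⟨?_, ?_, ?_, ?_⟩
  · refine le_trans ?_ (gain hNs (hg₁.pos hs).le (bound s x hs).1 (norm_nonneg x))
    rw [← le_div_iff₀' (hg₁.pos ht), hL _ _ ht, forward (hinv₂ t s hs hst) o₂₁,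
      forward (hinv₃ t s hs hst) o₃₁]
    simp only [map_zero, norm_zero, mul_zero, Real.iSup_const_zero, add_zero]
    refine ciSup_le fun τ => ?_
    rw [evolve (hinv₁ t s hs hst) (hP₁proj s hs) τ.1 τ.2]
    exact key₁ τ.1 t s x hs hst τ.2
  · refine le_trans ?_ (gain hNt (hg₂.pos hs).le (bound t x ht).1 (norm_nonneg x))
    rw [← le_div_iff₀' (hg₂.pos ht), hL _ _ hs, backward (hV₂rng t s x hs hst) o₁₂,
      backward (hV₂rng t s x hs hst) o₃₂]
    simp only [map_zero, norm_zero, mul_zero, Real.iSup_const_zero, add_zero, zero_add]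
    refine ciSup_le fun r => ?_
    rw [backward_cocycle hU_cocycle hV₂UV hV₂VU hV₂rng r.2.1 r.2.2 hst]
    exact key₂ r.1 s t x r.2.1 r.2.2 hst
  · refine le_trans ?_ (gain₂ hNs (hg₃.pos ht).le (bound s x hs).1 (norm_nonneg x))
    rw [hL _ _ ht, forward (hinv₁ t s hs hst) o₁₃, forward (hinv₂ t s hs hst) o₂₃]
    simp only [map_zero, norm_zero, mul_zero, Real.iSup_const_zero, zero_add]
    rw [mul_add]
    refine add_le_add ?_ ?_ <;> rw [← le_div_iff₀' (hg₃.pos hs)]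
    · refine ciSup_le fun τ => ?_
      rw [evolve (hinv₃ t s hs hst) (hP₃proj s hs) τ.1 τ.2]
      exact key₃ τ.1 t s x hs hst τ.2
    · refine ciSup_le fun ⟨r, hr, hrt⟩ => ?_
      rw [le_div_iff₀ (hg₃.pos hs)]
      rcases le_total r s with hrs | hsr
      · rw [← backward_cocycle hU_cocycle hV₃UV hV₃VU hV₃rng hr hrs hst,
          range_invariant (hP₃proj s hs) (hinv₃ t s hs hst), hV₃VU t s x hs hst]
        have hPP : P₃ s (P₃ s x) = P₃ s x := DFunLike.congr_fun (hP₃proj s hs) x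
        rw [hPP, div_mul_eq_mul_div, ← mul_assoc, mul_right_comm]
        have hV : h₄ r * ‖V₃ s r (P₃ s x)‖ / h₄ t ≤ N s * ‖x‖ := by
          rw [div_le_iff₀ (hg₄.pos ht)]
          refine (htri s r x hr hrs).2.2.2.trans ?_
          calc N s * (h₄ s * ‖x‖) ≤ N s * (h₄ t * ‖x‖) := by
                gcongr
                exact hg₄.mono hs hst
            _ = N s * ‖x‖ * h₄ t := by ring
        have := hg₃.pos hs
        exact mul_le_mul hV (hg₃.mono hs hst) this.le (by positivity)
      · have hVU : V₃ t r (P₃ t (U t s (P₃ s x))) = U r s (P₃ s x) := by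
          rw [hU_cocycle t r s hs hsr hrt, ContinuousLinearMap.comp_apply,
            ← range_invariant (hP₃proj s hs) (hinv₃ r s hs hsr),
            range_invariant (hP₃proj r hr) (hinv₃ t r hr hrt), hV₃VU t r _ hr hrt]
        rw [hVU]
        calc h₄ r / h₄ t * ‖U r s (P₃ s x)‖ * h₃ s
            ≤ 1 * ‖U r s (P₃ s x)‖ * h₃ s := by
              have := hg₃.pos hs
              gcongr
              exact hg₄.div_le_one hr hrt
          _ ≤ N s * (h₃ r * ‖x‖) := by linarith [(htri r s x hs hsr).2.2.1]
          _ ≤ N s * (h₃ t * ‖x‖) := by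
              gcongr
              exact hg₃.mono hr hrt
  · refine le_trans ?_ (gain₂ hNt (hg₄.pos ht).le (bound t x ht).1 (norm_nonneg x))
    rw [hL _ _ hs, backward (hV₃rng t s x hs hst) o₁₃, backward (hV₃rng t s x hs hst) o₂₃]
    simp only [map_zero, norm_zero, mul_zero, Real.iSup_const_zero, zero_add]
    rw [mul_add]
    refine add_le_add ?_ ?_ <;> rw [← le_div_iff₀' (hg₄.pos hs)]
    · refine ciSup_le fun ⟨τ, hτ⟩ => ?_
      rw [le_div_iff₀ (hg₄.pos hs), ← hV₃rng t s x hs hst]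
      have hτ0 := hs.trans hτ
      rcases le_total τ t with hτt | htτ
      · rw [forward_backward hU_cocycle hV₃UV hV₃VU hV₃rng hs hτ hτt]
        have := hg₄.pos hτ0
        calc h₃ s / h₃ τ * ‖V₃ t τ (P₃ t x)‖ * h₄ s
            ≤ 1 * ‖V₃ t τ (P₃ t x)‖ * h₄ τ := by
              have := hg₄.pos hs
              gcongr
              · exact hg₃.div_le_one hs hτ
              · exact hg₄.mono hs hτ
          _ ≤ N t * (h₄ t * ‖x‖) := by linarith [(htri t τ x hτ0 hτt).2.2.2]
      · rw [hU_cocycle τ t s hs hst htτ, ContinuousLinearMap.comp_apply, hV₃UV t s x hs hst]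
        have hUP : h₃ s * ‖U τ t (P₃ t x)‖ ≤ h₃ τ * (N t * ‖x‖) := by
          calc h₃ s * ‖U τ t (P₃ t x)‖ ≤ h₃ t * ‖U τ t (P₃ t x)‖ := by
                gcongr
                exact hg₃.mono hs hst
            _ ≤ h₃ τ * (N t * ‖x‖) := by linarith [(htri τ t x ht htτ).2.2.1]
        rw [← div_le_iff₀' (hg₃.pos hτ0), ← div_mul_eq_mul_div] at hUP
        have := hg₄.pos hs
        calc h₃ s / h₃ τ * ‖U τ t (P₃ t x)‖ * h₄ s ≤ N t * ‖x‖ * h₄ t := by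
              gcongr ?_ * ?_
              exact hg₄.mono hs hst
          _ = N t * (h₄ t * ‖x‖) := by ring
    · refine ciSup_le fun r => ?_
      rw [backward_cocycle hU_cocycle hV₃UV hV₃VU hV₃rng r.2.1 r.2.2 hst]
      exact key₄ r.1 s t x r.2.1 r.2.2 hst
end
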